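/- For all integers n ≥ 2, the sum over all Catalan–Stanley trees τ of size n of the size of the r-th reduction ρ^r(τ) equals binom(2n-2r-4, n-2) + C_{n-2}; equivalently, the expected size of the r-th ancestor of a uniformly random Catalan–Stanley tree of size n is binom(2n-2r-4, n-2)/C_{n-2} + 1 (for n, r ≥ 1). -/

import Mathlib

inductive PTree : Type
  | node : List PTree → PTree

namespace PTree

/-- number of nodes of a plane tree -/
def size : PTree → ℕ
  | node ts => 1 + (ts.attach.map (fun x => size x.1)).sum
decreasing_by
  have := List.sizeOf_lt_of_mem x.2
  simp only [PTree.node.sizeOf_spec]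
  omega

/-- depth of the rightmost leaf of a tree (following last children). -/
def rdepth : PTree → ℕ
  | node ts => ((ts.attach.map (fun x => 1 + rdepth x.1)).getLast?).getD 0
decreasing_by
  have := List.sizeOf_lt_of_mem x.2
  simp only [PTree.node.sizeOf_spec]
  omega

/-- A Catalan–Stanley tree: the rightmost leaf of every branch attached to
the root has odd distance to the root, i.e. every branch has even `rdepth`. -/
def isCS : PTree → Prop
  | node ts => ∀ t ∈ ts, Even (rdepth t)

/-- The age of a Catalan–Stanley tree: `(M+1)/2`, where `M` is the maximal
depth (distance from the root) of the rightmost leaves of the branches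
attached to the root; this is `r` iff `M = 2r-1`, and `0` for the
single-node tree. -/
def age : PTree → ℕ
  | node ts => ((ts.map (fun t => 1 + rdepth t)).foldr max 0 + 1) / 2

/-- The reduction `ρ` acting on a branch attached to the root whose rightmost
leaf is not a child of the root: the grandparent of the rightmost leaf
(the node at rightmost depth `rdepth - 2`) loses all of its subtrees. -/
def reduceBranch : PTree → PTree
  | node [] => node []
  | node (t :: ts) =>
    if 2 < rdepth (node (t :: ts)) then
      node ((t :: ts).dropLast ++ [reduceBranch ((t :: ts).getLast (by simp))])
    else node []
termination_by t => sizeOf t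
decreasing_by
  simp only [node.sizeOf_spec]
  have := List.sizeOf_lt_of_mem (List.getLast_mem (l := t :: ts) (by simp))
  omega

/-- The reduction `ρ`: rightmost leaves of branches which are children of the
root are deleted (i.e. single-node branches disappear), and in every other
branch the grandparent of its rightmost leaf loses all its subtrees. -/
def reduce : PTree → PTree
  | node ts => node ((ts.filter (fun t => t.size != 1)).map reduceBranch)

end PTree

/-- The binomial coefficient for integer arguments: `0` whenever the upper
argument is negative or the lower argument is negative or out of range. -/
def zchoose (a b : ℤ) : ℤ := if 0 ≤ a ∧ 0 ≤ b then a.toNat.choose b.toNat else 0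

open PTree

namespace PTree

open Finset PowerSeries

lemma size_node (ts : List PTree) : size (node ts) = 1 + (ts.map size).sum := by
  rw [size, List.attach_map_val (f := size)]

lemma size_pos (t : PTree) : 0 < size t := by
  cases t
  rw [size_node]
  omega

lemma rdepth_leaf : rdepth (node []) = 0 := by
  simp [rdepth]

lemma rdepth_snoc (ts : List PTree) (t : PTree) :
    rdepth (node (ts ++ [t])) = rdepth t + 1 := by
  rw [rdepth, List.attach_map_val (f := fun x => 1 + rdepth x)]
  simp [add_comm]

lemma reduceBranch_leaf : reduceBranch (node []) = node [] := by
  rw [reduceBranch]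

lemma reduceBranch_snoc (ts : List PTree) (t : PTree) :
    reduceBranch (node (ts ++ [t])) =
      if 1 < rdepth t then node (ts ++ [reduceBranch t]) else node [] := by
  have h := rdepth_snoc ts t
  cases ts with
  | nil =>
    rw [List.nil_append] at h ⊢
    rw [reduceBranch, h]
    simp [Nat.succ_le_iff]
  | cons u us =>
    rw [List.cons_append] at h ⊢
    rw [reduceBranch, h]
    have : (u :: (us ++ [t])) = (u :: us) ++ [t] := rfl
    simp only [this, List.dropLast_concat, List.getLast_append_singleton]
    simp [Nat.succ_le_iff]

lemma snocInduction {P : PTree → Prop} (leaf : P (node []))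
    (snoc : ∀ ts t, P t → P (node (ts ++ [t]))) : ∀ t, P t
  | node ts => by
    rcases List.eq_nil_or_concat' ts with rfl | ⟨us, u, rfl⟩
    · exact leaf
    · exact snoc us u (snocInduction leaf snoc u)
termination_by t => sizeOf t
decreasing_by
  have : sizeOf u < sizeOf ts := List.sizeOf_lt_of_mem (by simp_all)
  simp only [node.sizeOf_spec]
  simp_all
  omega

lemma eq_leaf_of_rdepth_eq_zero {t : PTree} (h : rdepth t = 0) : t = node [] := by
  induction t using snocInduction with
  | leaf => rfl
  | snoc ts t _ => simp [rdepth_snoc] at h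

lemma size_eq_one_iff {t : PTree} : size t = 1 ↔ rdepth t = 0 := by
  constructor
  · induction t using snocInduction with
    | leaf => simp [rdepth_leaf]
    | snoc ts t _ =>
      have := size_pos t
      simp only [size_node, List.map_append, List.sum_append, List.map_cons, List.sum_cons]
      omega
  · intro h
    rw [eq_leaf_of_rdepth_eq_zero h, size_node]
    simp

lemma rdepth_reduceBranch (t : PTree) : rdepth (reduceBranch t) = rdepth t - 2 := by
  induction t using snocInduction with
  | leaf => simp [reduceBranch_leaf, rdepth_leaf]
  | snoc ts t ih =>
    rw [reduceBranch_snoc, rdepth_snoc]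
    split_ifs with h
    · rw [rdepth_snoc, ih]
      omega
    · rw [rdepth_leaf]
      omega

lemma rdepth_reduceBranch_iterate (r : ℕ) (t : PTree) :
    rdepth (reduceBranch^[r] t) = rdepth t - 2 * r := by
  induction r generalizing t with
  | zero => simp
  | succ r ih =>
    rw [Function.iterate_succ_apply, ih, rdepth_reduceBranch]
    omega

lemma reduceBranch_iterate_snoc (r : ℕ) (ts : List PTree) (t : PTree) (h : 2 * r ≤ rdepth t) :
    reduceBranch^[r] (node (ts ++ [t])) = node (ts ++ [reduceBranch^[r] t]) := by
  induction r generalizing t with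
  | zero => rfl
  | succ r ih =>
    rw [Function.iterate_succ_apply, reduceBranch_snoc, if_pos (by omega), ih,
      Function.iterate_succ_apply]
    rw [rdepth_reduceBranch]
    omega

/-- The contribution of a branch to the size of the `r`-th reduction. -/
def reducedSize (r : ℕ) (t : PTree) : ℕ :=
  if 2 * r ≤ rdepth t then size (reduceBranch^[r] t) else 0

lemma size_reduce_iterate (r : ℕ) (ts : List PTree) (h : ∀ t ∈ ts, Even (rdepth t)) :
    size (reduce^[r] (node ts)) = 1 + (ts.map (reducedSize r)).sum := by
  induction r generalizing ts with
  | zero =>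
    have : reducedSize 0 = size := by
      ext t
      simp [reducedSize]
    rw [this, Function.iterate_zero, id, size_node]
  | succ r ih =>
    rw [Function.iterate_succ_apply, reduce, ih]
    · congr 1
      induction ts with
      | nil => simp
      | cons t ts iht =>
        have iht := iht fun u hu => h u (List.mem_cons_of_mem _ hu)
        obtain ⟨k, hk⟩ := h t List.mem_cons_self
        rw [List.filter_cons, List.map_cons, List.sum_cons, ← iht]
        by_cases h1 : size t = 1
        · have h0 := size_eq_one_iff.1 h1
          simp [h1, reducedSize, h0]
        · have h0 := mt size_eq_one_iff.2 h1
          simp only [bne_iff_ne, ne_eq, h1, not_false_eq_true, if_true, List.map_cons,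
            List.sum_cons, reducedSize, rdepth_reduceBranch, Function.iterate_succ_apply]
          congr 1
          exact if_congr (by omega) rfl rfl
    · intro u hu
      obtain ⟨t, ht, rfl⟩ := List.mem_map.1 hu
      obtain ⟨k, hk⟩ := h t (List.mem_of_mem_filter ht)
      exact ⟨k - 1, by rw [rdepth_reduceBranch]; omega⟩

/-- The number of nodes of a forest. -/
def forestSize (ts : List PTree) : ℕ := (ts.map size).sum

lemma finite_forests (n : ℕ) : {l : List PTree | forestSize l = n}.Finite := by
  induction n using Nat.strong_induction_on with
  | _ n ih =>
    have hfin : (⋃ i : Fin n, ⋃ j : Fin n, Set.image2 (fun us ts => node us :: ts)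
        {l | forestSize l = i} {l | forestSize l = j}).Finite :=
      Set.finite_iUnion fun i => Set.finite_iUnion fun j => (ih i i.2).image2 _ (ih j j.2)
    refine (hfin.insert []).subset ?_
    rintro (_ | ⟨⟨us⟩, ts⟩) h
    · exact Set.mem_insert _ _
    · simp only [Set.mem_ofPred_eq, forestSize, List.map_cons, List.sum_cons, size_node] at h
      refine Set.mem_insert_of_mem _ (Set.mem_iUnion.2 ⟨⟨forestSize us, ?_⟩,
        Set.mem_iUnion.2 ⟨⟨forestSize ts, ?_⟩, ⟨us, rfl, ts, rfl, rfl⟩⟩⟩)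
      all_goals
        unfold forestSize
        omega

lemma finite_trees (n : ℕ) : {t : PTree | size t = n}.Finite := by
  refine ((finite_forests (n - 1)).image node).subset ?_
  rintro ⟨ts⟩ h
  refine ⟨ts, ?_, rfl⟩
  simp only [Set.mem_ofPred_eq, size_node] at h
  simp only [Set.mem_ofPred_eq, forestSize]
  omega

/-- The forests with `n` nodes. -/
noncomputable def forests (n : ℕ) : Finset (List PTree) := (finite_forests n).toFinset

/-- The trees with `n` nodes. -/
noncomputable def trees (n : ℕ) : Finset PTree := (finite_trees n).toFinset

@[simp] lemma mem_forests {n : ℕ} {l : List PTree} : l ∈ forests n ↔ forestSize l = n := by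
  simp [forests]

@[simp] lemma mem_trees {n : ℕ} {t : PTree} : t ∈ trees n ↔ size t = n := by
  simp [trees]

/-- The generating function of trees by number of nodes, weighted by `w`. -/
noncomputable def treeGF (w : PTree → ℤ) : ℤ⟦X⟧ := PowerSeries.mk fun n => ∑ t ∈ trees n, w t

/-- The generating function of forests by number of nodes, weighted by `w`. -/
noncomputable def forestGF (w : List PTree → ℤ) : ℤ⟦X⟧ :=
  PowerSeries.mk fun n => ∑ l ∈ forests n, w l

lemma treeGF_eq_X_mul (w : PTree → ℤ) : treeGF w = X * forestGF fun l => w (node l) := by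
  ext n
  cases n with
  | zero =>
    rw [treeGF, coeff_mk, coeff_zero_X_mul]
    refine Finset.sum_eq_zero fun t ht => ?_
    have := size_pos t
    have := mem_trees.1 ht
    omega
  | succ n =>
    rw [treeGF, coeff_mk, coeff_succ_X_mul, forestGF, coeff_mk]
    symm
    refine Finset.sum_bij (fun l _ => node l) ?_ ?_ ?_ ?_
    · intro l hl
      simp only [mem_forests, forestSize] at hl
      rw [mem_trees, size_node]
      omega
    · intro l _ l' _ h
      exact node.inj h
    · rintro ⟨l⟩ hl
      rw [mem_trees, size_node] at hl
      exact ⟨l, by simp only [mem_forests, forestSize]; omega, rfl⟩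
    · intros
      rfl

lemma forestGF_eq_of_decomposition (f : PTree → List PTree → List PTree)
    (size_f : ∀ t l, forestSize (f t l) = size t + forestSize l)
    (inj : ∀ t l t' l', f t l = f t' l' → t = t' ∧ l = l')
    (surj : ∀ l, l ≠ [] → ∃ t l', f t l' = l)
    (w x x' : List PTree → ℤ) (u u' : PTree → ℤ)
    (h : ∀ t l, w (f t l) = u t * x l + u' t * x' l) :
    forestGF w = C (w []) + treeGF u * forestGF x + treeGF u' * forestGF x' := by
  classical
  ext n
  simp only [map_add, coeff_mul, treeGF, forestGF, coeff_mk, coeff_C]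
  rw [← Finset.sum_filter_add_sum_filter_not (forests n) (· = []), add_assoc]
  congr 1
  · split_ifs with hn
    · subst hn
      rw [Finset.sum_eq_single_of_mem []]
      · simp [forestSize]
      · intro l hl hl'
        exact absurd (Finset.mem_filter.1 hl).2 hl'
    · refine Finset.sum_eq_zero fun l hl => ?_
      rw [Finset.mem_filter, mem_forests] at hl
      obtain ⟨h1, rfl⟩ := hl
      exact absurd h1.symm hn
  · simp only [← Finset.sum_add_distrib, Finset.sum_mul_sum, ← h]
    simp only [← Finset.sum_product']
    rw [Finset.sum_sigma']
    symm
    refine Finset.sum_bij (fun a _ => f a.2.1 a.2.2) ?_ ?_ ?_ ?_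
    · rintro ⟨⟨i, j⟩, t, l⟩ ha
      simp only [Finset.mem_sigma, Finset.mem_product, mem_trees, mem_forests] at ha
      obtain ⟨hij, ht, hl⟩ := ha
      have hij : i + j = n := Finset.HasAntidiagonal.mem_antidiagonal.1 hij
      dsimp only at ht hl ⊢
      rw [Finset.mem_filter, mem_forests, size_f]
      refine ⟨by omega, fun h0 => ?_⟩
      have h1 := size_f t l
      have h2 := size_pos t
      simp only [h0, forestSize, List.map_nil, List.sum_nil] at h1
      omega
    · rintro ⟨⟨i, j⟩, t, l⟩ ha ⟨⟨i', j'⟩, t', l'⟩ ha' heq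
      simp only [Finset.mem_sigma, Finset.mem_product, mem_trees, mem_forests] at ha ha'
      obtain ⟨rfl, rfl⟩ := inj _ _ _ _ heq
      obtain ⟨-, rfl, rfl⟩ := ha
      obtain ⟨-, rfl, rfl⟩ := ha'
      rfl
    · intro l hl
      rw [Finset.mem_filter, mem_forests] at hl
      obtain ⟨t, l', rfl⟩ := surj l hl.2
      refine ⟨⟨(size t, forestSize l'), t, l'⟩, ?_, rfl⟩
      simp [← hl.1, size_f]
    · intros
      rfl

lemma forestGF_cons (w x x' : List PTree → ℤ) (u u' : PTree → ℤ)
    (h : ∀ t l, w (t :: l) = u t * x l + u' t * x' l) :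
    forestGF w = C (w []) + treeGF u * forestGF x + treeGF u' * forestGF x' := by
  refine forestGF_eq_of_decomposition List.cons ?_ ?_ ?_ w x x' u u' h
  · simp [forestSize]
  · intro t l t' l' h
    simpa using h
  · intro l hl
    exact ⟨_, _, List.cons_head_tail hl⟩

lemma forestGF_snoc (w x x' : List PTree → ℤ) (u u' : PTree → ℤ)
    (h : ∀ t l, w (l ++ [t]) = u t * x l + u' t * x' l) :
    forestGF w = C (w []) + treeGF u * forestGF x + treeGF u' * forestGF x' := by
  refine forestGF_eq_of_decomposition (fun t l => l ++ [t]) ?_ ?_ ?_ w x x' u u' h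
  · simp [forestSize, add_comm]
  · intro t l t' l' h
    have := List.append_inj' h rfl
    simpa [and_comm] using this
  · intro l hl
    exact ⟨_, _, List.dropLast_append_getLast hl⟩

/-- The generating function `T` of plane trees. -/
noncomputable def planeGF : ℤ⟦X⟧ := treeGF fun _ => 1

/-- The generating function `z T'` of plane trees weighted by their size. -/
noncomputable def sizeGF : ℤ⟦X⟧ := treeGF fun t => size t

lemma treeGF_zero : treeGF (fun _ => 0) = 0 := by
  ext n
  simp [treeGF]

lemma treeGF_snoc (w p q : PTree → ℤ)
    (h : ∀ ts t, w (node (ts ++ [t])) = p t * size (node ts) + q t) :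
    treeGF w = C (w (node [])) * X + sizeGF * treeGF p + planeGF * treeGF q := by
  rw [treeGF_eq_X_mul w, sizeGF, planeGF, treeGF_eq_X_mul (fun t => (size t : ℤ)),
    treeGF_eq_X_mul (fun _ => 1),
    forestGF_snoc (fun l => w (node l)) (fun l => size (node l)) (fun _ => 1) p q
      fun t l => by rw [h, mul_one]]
  ring

lemma one_sub_mul_forestGF_one : (1 - planeGF) * forestGF (fun _ => 1) = 1 := by
  have := forestGF_cons (fun _ => 1) (fun _ => 1) (fun _ => 0) (fun _ => 1) (fun _ => 0)
    (by simp)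
  rw [treeGF_zero, map_one, ← planeGF] at this
  linear_combination this

lemma planeGF_mul_one_sub : planeGF * (1 - planeGF) = X := by
  have h : planeGF = X * forestGF fun _ => 1 := treeGF_eq_X_mul _
  linear_combination (1 - planeGF) * h + X * one_sub_mul_forestGF_one

lemma sizeGF_mul : sizeGF * (1 - 2 * planeGF) = X := by
  have h : sizeGF = X * forestGF fun l => (size (node l) : ℤ) := treeGF_eq_X_mul _
  have h' := forestGF_cons (fun l => (size (node l) : ℤ)) (fun _ => 1)
    (fun l => (size (node l) : ℤ)) (fun t => size t) (fun _ => 1) fun t l => by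
      simp only [size_node, List.map_cons, List.sum_cons]
      push_cast
      ring
  rw [← sizeGF, ← planeGF, size_node] at h'
  simp only [List.map_nil, List.sum_nil, add_zero, Nat.cast_one, map_one] at h'
  have h1 : planeGF = X * forestGF fun _ => 1 := treeGF_eq_X_mul _
  linear_combination (1 - planeGF) * h + X * h' - sizeGF * h1

lemma treeGF_rdepth_eq (d : ℕ) :
    treeGF (fun t => if rdepth t = d then 1 else 0) = X * planeGF ^ d := by
  induction d with
  | zero =>
    rw [treeGF_snoc _ (fun _ => 0) (fun _ => 0) (by simp [rdepth_snoc]), treeGF_zero]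
    simp [rdepth_leaf]
  | succ d ih =>
    rw [treeGF_snoc _ (fun _ => 0) (fun t => if rdepth t = d then 1 else 0)
      (by simp [rdepth_snoc]), treeGF_zero, ih]
    rw [rdepth_leaf, if_neg (by omega), map_zero]
    ring

lemma treeGF_add (u v : PTree → ℤ) : treeGF (fun t => u t + v t) = treeGF u + treeGF v := by
  ext n
  simp [treeGF, Finset.sum_add_distrib]

/-- The generating function of branches of Catalan–Stanley trees. -/
noncomputable def branchGF : ℤ⟦X⟧ := treeGF fun t => if Even (rdepth t) then 1 else 0

/-- The generating function of branches of Catalan–Stanley trees, weighted by their contribution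
to the size of the `r`-th reduction. -/
noncomputable def reducedBranchGF (r : ℕ) : ℤ⟦X⟧ :=
  treeGF fun t => if Even (rdepth t) then (reducedSize r t : ℤ) else 0

lemma one_sub_planeGF_ne_zero : (1 - planeGF : ℤ⟦X⟧) ≠ 0 :=
  left_ne_zero_of_mul (one_sub_mul_forestGF_one ▸ one_ne_zero)

lemma branchGF_mul : branchGF * (1 + planeGF) = planeGF := by
  have h0 : branchGF = X + planeGF * treeGF fun t => if Even (rdepth t) then 0 else 1 := by
    rw [branchGF, treeGF_snoc _ (fun _ => 0) (fun t => if Even (rdepth t) then 0 else 1)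
      (by simp only [rdepth_snoc, Nat.even_add_one]; grind), treeGF_zero]
    simp [rdepth_leaf]
  have h1 : treeGF (fun t => if Even (rdepth t) then 0 else 1) = planeGF * branchGF := by
    rw [branchGF, treeGF_snoc _ (fun _ => 0) (fun t => if Even (rdepth t) then 1 else 0)
      (by simp only [rdepth_snoc, Nat.even_add_one]; grind), treeGF_zero]
    simp [rdepth_leaf]
  apply mul_left_cancel₀ one_sub_planeGF_ne_zero
  linear_combination h0 + planeGF * h1 - planeGF_mul_one_sub

lemma reducedSize_snoc (r : ℕ) (ts : List PTree) (t : PTree) :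
    reducedSize r (node (ts ++ [t])) =
      (if 2 * r ≤ rdepth t then 1 else 0) * size (node ts) + reducedSize r t +
        if rdepth t + 1 = 2 * r then 1 else 0 := by
  rcases lt_trichotomy (rdepth t + 1) (2 * r) with h | h | h
  · have h' := rdepth_snoc ts t
    simp only [reducedSize]
    rw [if_neg (by omega), if_neg (by omega), if_neg (by omega), if_neg (by omega)]
    simp
  · have h' := rdepth_reduceBranch_iterate r (node (ts ++ [t]))
    rw [rdepth_snoc, h, Nat.sub_self] at h'
    simp only [reducedSize]
    rw [if_pos (by rw [rdepth_snoc]; omega), if_neg (by omega), if_neg (by omega), if_pos h,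
      size_eq_one_iff.2 h']
    simp
  · have h' := rdepth_snoc ts t
    simp only [reducedSize]
    rw [if_pos (by omega), if_pos (by omega), if_pos (by omega), if_neg (by omega),
      reduceBranch_iterate_snoc _ _ _ (by omega)]
    simp only [size_node, List.map_append, List.sum_append, List.map_cons, List.sum_cons,
      List.map_nil, List.sum_nil]
    ring

lemma reducedBranchGF_mul {r : ℕ} (hr : 1 ≤ r) :
    reducedBranchGF r * (1 + planeGF) ^ 2 * (1 - 2 * planeGF) = X * planeGF ^ (2 * r) := by
  obtain ⟨k, rfl⟩ : ∃ k, r = k + 1 := ⟨r - 1, by omega⟩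
  set r := k + 1 with hrk
  set a0 : PTree → ℤ := fun t => if Even (rdepth t) ∧ 2 * r ≤ rdepth t then 1 else 0 with ha0
  set a1 : PTree → ℤ := fun t => if ¬ Even (rdepth t) ∧ 2 * r ≤ rdepth t then 1 else 0 with ha1
  set d1 : PTree → ℤ := fun t => if Even (rdepth t) then 0 else (reducedSize r t : ℤ) with hd1
  set e : PTree → ℤ := fun t => if rdepth t = 2 * k + 1 then 1 else 0 with he
  have he' : treeGF e = X * planeGF ^ (2 * k + 1) := treeGF_rdepth_eq _
  have hA0 : treeGF a0 = planeGF * (treeGF a1 + treeGF e) := by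
    rw [← treeGF_add, treeGF_snoc a0 (fun _ => 0) (fun t => a1 t + e t), treeGF_zero]
    · simp [ha0, rdepth_leaf, hrk]
    · intro ts t
      simp only [ha0, ha1, he, rdepth_snoc]
      grind
  have hA1 : treeGF a1 = planeGF * treeGF a0 := by
    rw [treeGF_snoc a1 (fun _ => 0) a0, treeGF_zero]
    · simp [ha1, rdepth_leaf]
    · intro ts t
      simp only [ha0, ha1, rdepth_snoc]
      grind
  have hD0 : reducedBranchGF r =
      sizeGF * treeGF a1 + planeGF * (treeGF d1 + treeGF e) := by
    rw [← treeGF_add, reducedBranchGF, treeGF_snoc _ a1 (fun t => d1 t + e t)]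
    · simp [reducedSize, rdepth_leaf, hrk]
    · intro ts t
      simp only [ha1, hd1, he, rdepth_snoc, reducedSize_snoc]
      push_cast
      grind
  have hD1 : treeGF d1 = sizeGF * treeGF a0 + planeGF * reducedBranchGF r := by
    rw [reducedBranchGF, treeGF_snoc d1 a0 (fun t => if Even (rdepth t) then reducedSize r t else 0)]
    · simp [hd1, rdepth_leaf]
    · intro ts t
      simp only [ha0, hd1, rdepth_snoc, reducedSize_snoc]
      push_cast
      grind
  have hA : treeGF a0 * (1 + planeGF) = planeGF ^ (2 * k + 3) := by
    apply mul_left_cancel₀ one_sub_planeGF_ne_zero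
    linear_combination hA0 + planeGF * hA1 + planeGF * he' -
      planeGF ^ (2 * k + 2) * planeGF_mul_one_sub
  apply mul_left_cancel₀ one_sub_planeGF_ne_zero
  have hD : reducedBranchGF r * (1 - planeGF ^ 2) =
      2 * sizeGF * planeGF * treeGF a0 + X * planeGF ^ (2 * k + 2) := by
    linear_combination hD0 + planeGF * hD1 + sizeGF * hA1 + planeGF * he'
  have hr2 : 2 * r = 2 * k + 2 := by omega
  rw [hr2]
  linear_combination (1 + planeGF) * (1 - 2 * planeGF) * hD +
    2 * planeGF * (1 + planeGF) * treeGF a0 * sizeGF_mul + 2 * X * planeGF * hA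

/-- The sum of the sizes of the `r`-th reductions of Catalan–Stanley trees, as a generating
function by the number of nodes of the original tree. -/
noncomputable def reductionGF (r : ℕ) : ℤ⟦X⟧ := by
  classical exact treeGF fun t => if isCS t then (size (reduce^[r] t) : ℤ) else 0

lemma reductionGF_mul {r : ℕ} (hr : 1 ≤ r) :
    (reductionGF r - X * (1 + planeGF)) * (1 - 2 * planeGF) = X ^ 2 * planeGF ^ (2 * r) := by
  set P : List PTree → ℤ := fun ts => if ∀ t ∈ ts, Even (rdepth t) then 1 else 0 with hP
  set Q : List PTree → ℤ := fun ts => P ts * ((ts.map (reducedSize r)).sum : ℕ) with hQ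
  have hLP := forestGF_cons P P (fun _ => 0) (fun t => if Even (rdepth t) then 1 else 0)
    (fun _ => 0) fun t l => by
      simp only [hP, List.forall_mem_cons]
      grind
  have hLQ := forestGF_cons Q P Q (fun t => if Even (rdepth t) then reducedSize r t else 0)
    (fun t => if Even (rdepth t) then 1 else 0) fun t l => by
      simp only [hQ, hP, List.forall_mem_cons, List.map_cons, List.sum_cons]
      push_cast
      grind
  rw [treeGF_zero, ← branchGF] at hLP
  rw [← branchGF, ← reducedBranchGF] at hLQ
  have hP0 : P [] = 1 := by simp [hP]
  have hQ0 : Q [] = 0 := by simp [hQ]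
  rw [hP0, map_one] at hLP
  rw [hQ0, map_zero] at hLQ
  have hR : reductionGF r = X * (forestGF P + forestGF Q) := by
    classical
    rw [reductionGF, treeGF_eq_X_mul]
    congr 1
    ext n
    simp only [forestGF, coeff_mk, map_add, ← Finset.sum_add_distrib]
    refine Finset.sum_congr rfl fun l _ => ?_
    by_cases h : ∀ t ∈ l, Even (rdepth t)
    · rw [if_pos (by exact h), size_reduce_iterate r l h]
      simp only [hQ, hP, if_pos h]
      push_cast
      ring
    · rw [if_neg (by exact h)]
      simp only [hQ, hP, if_neg h]
      ring
  have hP1 : forestGF P = 1 + planeGF := by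
    linear_combination (1 + planeGF) * hLP + forestGF P * branchGF_mul
  have hQ1 : forestGF Q = reducedBranchGF r * (1 + planeGF) ^ 2 := by
    linear_combination (1 + planeGF) * hLQ + forestGF Q * branchGF_mul +
      reducedBranchGF r * (1 + planeGF) * hP1
  rw [hR, hP1, hQ1]
  linear_combination X * reducedBranchGF_mul hr

lemma planeGF_eq_X_mul_catalan : planeGF = X * PowerSeries.mk fun n => (catalan n : ℤ) := by
  set c : ℤ⟦X⟧ := PowerSeries.mk fun n => (catalan n : ℤ) with hc
  have hcat : c ^ 2 * X + 1 = c := by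
    have h := congrArg (PowerSeries.map (Nat.castRingHom ℤ)) catalanSeries_sq_mul_X_add_one
    have hmap : PowerSeries.map (Nat.castRingHom ℤ) catalanSeries = c := by
      ext n
      simp [hc]
    simpa [hmap] using h
  have hne : 1 - planeGF - X * c ≠ 0 := by
    intro h
    have h' := congrArg constantCoeff h
    rw [planeGF, treeGF_eq_X_mul] at h'
    simp at h'
  have h0 : (planeGF - X * c) * (1 - planeGF - X * c) = 0 := by
    linear_combination planeGF_mul_one_sub + X * hcat
  exact sub_eq_zero.1 ((mul_eq_zero.1 h0).resolve_right hne)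

lemma sizeGF_eq_X_mul_centralBinom :
    sizeGF = X * PowerSeries.mk fun n => (n.centralBinom : ℤ) := by
  have h : ∀ n, coeff n sizeGF = n * coeff n planeGF := by
    intro n
    simp only [sizeGF, planeGF, treeGF, coeff_mk, Finset.mul_sum, mul_one]
    exact Finset.sum_congr rfl fun t ht => by rw [mem_trees.1 ht]
  ext n
  rw [h, planeGF_eq_X_mul_catalan]
  cases n with
  | zero => simp
  | succ n =>
    rw [coeff_succ_X_mul, coeff_succ_X_mul, coeff_mk, coeff_mk]
    exact_mod_cast succ_mul_catalan_eq_centralBinom n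

/-- The generating function of the numbers `binom(2n - k, n)`. -/
noncomputable def chooseGF (k : ℕ) : ℤ⟦X⟧ :=
  PowerSeries.mk fun n => if k ≤ 2 * n then ((2 * n - k).choose n : ℤ) else 0

lemma chooseGF_add_two (k : ℕ) : chooseGF (k + 2) = chooseGF (k + 1) - X * chooseGF k := by
  ext n
  cases n with
  | zero => simp [chooseGF]
  | succ n =>
    rw [map_sub, coeff_succ_X_mul]
    simp only [chooseGF, coeff_mk]
    rcases lt_trichotomy k (2 * n + 1) with h | rfl | h
    · rw [if_pos (by omega), if_pos (by omega), if_pos (by omega)]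
      have h1 : 2 * (n + 1) - (k + 1) = (2 * n - k) + 1 := by omega
      have h2 : 2 * (n + 1) - (k + 2) = 2 * n - k := by omega
      rw [h1, h2, Nat.choose_succ_succ]
      push_cast
      ring
    · rw [if_neg (by omega), if_pos (by omega), if_neg (by omega)]
      have h1 : 2 * (n + 1) - (2 * n + 1 + 1) = 0 := by omega
      rw [h1]
      simp
    · rw [if_neg (by omega), if_neg (by omega), if_neg (by omega)]
      simp

lemma chooseGF_mul (k : ℕ) : chooseGF k * (1 - 2 * planeGF) = planeGF ^ k := by
  have h0 : chooseGF 0 * (1 - 2 * planeGF) = 1 := by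
    have h : sizeGF = X * chooseGF 0 := by
      rw [sizeGF_eq_X_mul_centralBinom, chooseGF]
      simp [Nat.centralBinom]
    apply mul_left_cancel₀ (X_ne_zero (R := ℤ))
    linear_combination sizeGF_mul - (1 - 2 * planeGF) * h
  have h1 : 2 * chooseGF 1 = chooseGF 0 - 1 := by
    ext n
    cases n with
    | zero => simp [chooseGF]
    | succ n =>
      have h2 : (2 : ℤ⟦X⟧) = C 2 := rfl
      rw [h2, coeff_C_mul, map_sub, coeff_one, if_neg (by omega)]
      simp only [chooseGF, coeff_mk]
      rw [if_pos (by omega), if_pos (by omega)]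
      have h3 : 2 * (n + 1) - 1 = 2 * n + 1 := by omega
      have h4 : 2 * (n + 1) - 0 = 2 * n + 1 + 1 := by omega
      have h5 := Nat.choose_symm_half n
      rw [h3, h4, Nat.choose_succ_succ (2 * n + 1) n, ← h5]
      push_cast
      ring
  induction k using Nat.twoStepInduction with
  | zero => rw [h0, pow_zero]
  | one =>
    apply mul_left_cancel₀ (a := (2 : ℤ⟦X⟧)) fun h => by
      have h' := congrArg constantCoeff h
      rw [map_ofNat, map_zero] at h'
      exact two_ne_zero h'
    linear_combination (1 - 2 * planeGF) * h1 + h0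
  | more k ih ih' =>
    rw [chooseGF_add_two]
    linear_combination ih' - X * ih + planeGF ^ k * planeGF_mul_one_sub

lemma reductionGF_eq {r : ℕ} (hr : 1 ≤ r) :
    reductionGF r = X * (1 + planeGF) + X ^ 2 * chooseGF (2 * r) := by
  have h0 := chooseGF_mul 0
  have h := reductionGF_mul hr
  rw [pow_zero] at h0
  have hne : (1 - 2 * planeGF : ℤ⟦X⟧) ≠ 0 := right_ne_zero_of_mul (h0 ▸ one_ne_zero)
  apply mul_right_cancel₀ hne
  linear_combination h - X ^ 2 * chooseGF_mul (2 * r)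

end PTree

/-- For `n ≥ 2` and `r ≥ 1`, the sum over all Catalan–Stanley trees `τ` of
size `n` of the size of the `r`-th reduction `ρ^r(τ)` equals
`binom(2n-2r-4, n-2) + C_{n-2}` (binomials with negative upper argument being
zero); equivalently, the expected size of the `r`-th ancestor of a uniformly
random Catalan–Stanley tree of size `n` is
`binom(2n-2r-4, n-2)/C_{n-2} + 1`. -/
theorem catalan_stanley_stmt11 (n r : ℕ) (hn : 2 ≤ n) (hr : 1 ≤ r)
    (s : Finset PTree)
    (hs : ∀ τ : PTree, τ ∈ s ↔ τ.isCS ∧ τ.size = n) :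
    ∑ τ ∈ s, ((reduce^[r] τ).size : ℤ) =
      zchoose (2 * n - 2 * r - 4) (n - 2) + (catalan (n - 2) : ℤ) := by
  classical
  obtain ⟨m, rfl⟩ : ∃ m, n = m + 2 := ⟨n - 2, by omega⟩
  have hs' : s = (trees (m + 2)).filter isCS := by
    ext τ
    rw [hs, Finset.mem_filter, mem_trees, and_comm]
  have hcoeff := congrArg (PowerSeries.coeff (m + 2)) (reductionGF_eq hr)
  rw [hs', Finset.sum_filter]
  simp only [reductionGF, treeGF, PowerSeries.coeff_mk] at hcoeff
  rw [hcoeff, map_add, PowerSeries.coeff_succ_X_mul, PowerSeries.coeff_X_pow_mul, map_add,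
    planeGF_eq_X_mul_catalan, PowerSeries.coeff_succ_X_mul, PowerSeries.coeff_mk,
    PowerSeries.coeff_one, if_neg (by omega), zero_add, add_comm, chooseGF, PowerSeries.coeff_mk,
    zchoose]
  congr 1
  by_cases h : 2 * r ≤ 2 * m
  · rw [if_pos h, if_pos (by omega)]
    congr 2 <;> omega
  · rw [if_neg h, if_neg (by omega)]
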